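/- arXiv:1609.09319 — 2 statements merged into one kernel-verified Lean document; each statement's English description precedes it below -/
import Mathlib

section
/- Let D be a square-free integer other than 1 and K = ℚ(√D). Let α = (α_1,…,α_r) and β = (β_1,…,β_s) with all α_i, β_j ∈ K∖ℤ_{≤0}, and let u = #{1≤i≤r : α_i ∈ ℚ} and v = #{1≤j≤s : β_j ∈ ℚ}. If u < v, then the hypergeometric series F_{α,β}(z) is not N-integral in K. -/
open scoped BigOperators

noncomputable section

/-- The coefficients of the hypergeometric series `F_{α,β}` with parameters in a field `K`. -/
def hgCoeffK {K : Type*} [Field K] {r s : ℕ} (α : Fin r → K) (β : Fin s → K) (n : ℕ) : K :=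
  (∏ i, (ascPochhammer K n).eval (α i)) / (∏ j, (ascPochhammer K n).eval (β j))

open Filter NumberTheorySymbols

theorem jacobiSym_eq_of_modEq {D : ℤ} {a b : ℕ} (ha : Odd a) (hb : Odd b)
    (h : a ≡ b [MOD 4 * D.natAbs]) : J(D | a) = J(D | b) := by
  rw [jacobiSym.mod_right D ha, jacobiSym.mod_right D hb, h]

theorem exists_jacobiSym_eq_neg_one_of_odd_prime_dvd {D : ℤ} (hD : Squarefree D) {q : ℕ}
    (hq : q.Prime) (hq2 : Odd q) (hqD : (q : ℤ) ∣ D) :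
    ∃ b : ℕ, b.Coprime (4 * D.natAbs) ∧ J(D | b) = -1 := by
  have : Fact q.Prime := ⟨hq⟩
  obtain ⟨m, rfl⟩ := hqD
  have hm : ¬ (q : ℤ) ∣ m := fun h ↦
    (Nat.prime_iff_prime_int.mp hq).not_isUnit (hD _ (mul_dvd_mul_left _ h))
  have hcop : q.Coprime (4 * m.natAbs) := by
    refine Nat.Coprime.mul_right (hq2.coprime_two_right.pow_right 2) ?_
    exact (Nat.Prime.coprime_iff_not_dvd hq).2 fun h ↦ hm (Int.natCast_dvd.2 h)
  obtain ⟨a, ha⟩ := FiniteField.exists_nonsquare (F := ZMod q)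
    (by rw [ZMod.ringChar_zmod_n]; rintro rfl; exact absurd hq2 (by decide))
  obtain ⟨b, hba, hb1⟩ := Nat.chineseRemainder hcop a.val 1
  have hbq : (b : ZMod q) = a := by
    rw [(ZMod.natCast_eq_natCast_iff _ _ _).2 hba, ZMod.natCast_zmod_val]
  have hb4 : b % 4 = 1 := hb1.of_mul_right m.natAbs
  have hbodd : Odd b := Nat.odd_iff.2 (Nat.odd_of_mod_four_eq_one hb4)
  refine ⟨b, ?_, ?_⟩
  · rw [Int.natAbs_mul, Int.natAbs_natCast, mul_left_comm]
    refine Nat.Coprime.mul_right ?_ ?_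
    · refine ((Nat.Prime.coprime_iff_not_dvd hq).2 fun h ↦ ha ?_).symm
      rw [← hbq, (ZMod.natCast_eq_zero_iff _ _).2 h]
      exact IsSquare.zero
    · rw [Nat.Coprime, hb1.gcd_eq, Nat.gcd_one_left]
  · rw [jacobiSym.mul_left, jacobiSym_eq_of_modEq hbodd odd_one hb1, jacobiSym.one_right, mul_one,
      jacobiSym.quadratic_reciprocity_one_mod_four' hq2 hb4, ZMod.nonsquare_iff_jacobiSym_eq_neg_one]
    simpa [hbq] using ha

theorem exists_jacobiSym_eq_neg_one {D : ℤ} (hD : Squarefree D) (hD1 : D ≠ 1) :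
    ∃ b : ℕ, b.Coprime (4 * D.natAbs) ∧ J(D | b) = -1 := by
  rcases Nat.eq_two_pow_or_exists_odd_prime_and_dvd D.natAbs with ⟨k, hk⟩ | ⟨q, hq, hqD, hq2⟩
  · have hsq : Squarefree (2 ^ k) := hk ▸ Int.squarefree_natAbs.2 hD
    have hk1 : k ≤ 1 := by
      by_contra! h
      exact absurd (hsq 2 ((pow_two 2).symm ▸ pow_dvd_pow 2 h)) (by decide)
    have hcases : D = -1 ∨ D = 2 ∨ D = -2 := by
      interval_cases k <;> omega
    rcases hcases with rfl | rfl | rfl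
    · exact ⟨3, by decide, by norm_num⟩
    · exact ⟨3, by decide, by norm_num⟩
    · exact ⟨5, by decide, by norm_num⟩
  · exact exists_jacobiSym_eq_neg_one_of_odd_prime_dvd hD hq hq2 (Int.natCast_dvd.2 hqD)

/-- A quadratic field has infinitely many inert primes. -/
theorem frequently_prime_and_jacobiSym_eq_neg_one {D : ℤ} (hD : Squarefree D) (hD1 : D ≠ 1) :
    ∃ᶠ p in atTop, p.Prime ∧ J(D | p) = -1 := by
  obtain ⟨b, hb, hJ⟩ := exists_jacobiSym_eq_neg_one hD hD1
  have hD0 : 4 * D.natAbs ≠ 0 := by simpa using hD.ne_zero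
  have h2 : 2 ∣ 4 * D.natAbs := Dvd.dvd.mul_right (by decide) _
  have hbodd : Odd b := (hb.coprime_dvd_right h2).odd_of_right
  refine (Nat.frequently_atTop_prime_and_modEq hD0 hb).mono fun p ⟨hp, hpb⟩ ↦ ⟨hp, ?_⟩
  have hpodd : Odd p := by
    rw [Nat.odd_iff] at hbodd ⊢
    exact Eq.trans (hpb.of_dvd h2) hbodd
  rw [jacobiSym_eq_of_modEq hpodd hbodd hpb, hJ]

theorem eventually_padicValRat_eq_zero {x : ℚ} (hx : x ≠ 0) :
    ∀ᶠ p in atTop, padicValRat p x = 0 := by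
  have hnum : x.num.natAbs ≠ 0 := by simpa using hx
  filter_upwards [eventually_gt_atTop x.num.natAbs, eventually_gt_atTop x.den] with p hp hp'
  rw [padicValRat_def, padicValInt,
    padicValNat.eq_zero_of_not_dvd (Nat.not_dvd_of_pos_of_lt (Nat.pos_of_ne_zero hnum) hp),
    padicValNat.eq_zero_of_not_dvd (Nat.not_dvd_of_pos_of_lt x.den_pos hp')]
  simp

theorem padicValRat_prod {ι : Type*} (p : ℕ) [Fact p.Prime] (s : Finset ι) (f : ι → ℚ)
    (hf : ∀ i ∈ s, f i ≠ 0) : padicValRat p (∏ i ∈ s, f i) = ∑ i ∈ s, padicValRat p (f i) := by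
  classical
  induction s using Finset.induction_on with
  | empty => simp
  | insert a s ha ih =>
    rw [Finset.forall_mem_insert] at hf
    rw [Finset.prod_insert ha, Finset.sum_insert ha,
      padicValRat.mul hf.1 (Finset.prod_ne_zero_iff.2 hf.2), ih hf.2]

/-- For large primes `p`, exactly one of `a, a + 1, …, a + p - 1` is divisible by `p`,
and exactly once. -/
theorem eventually_sum_padicValRat_add_eq_one {a : ℚ} (ha : ∀ k : ℕ, a + k ≠ 0) :
    ∀ᶠ p : ℕ in atTop, p.Prime → ∑ k ∈ Finset.range p, padicValRat p (a + k) = 1 := by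
  have hd : (a.den : ℚ) ≠ 0 := by simp
  filter_upwards [eventually_padicValRat_eq_zero hd, eventually_gt_atTop a.den,
    eventually_gt_atTop (a.num.natAbs + a.den)] with p hpd hdp hbig hp
  have : Fact p.Prime := ⟨hp⟩
  have hne (k : ℕ) : a.num + k * a.den ≠ 0 := by
    intro h
    apply ha k
    have h' : (a.num : ℚ) + k * a.den = 0 := mod_cast h
    rw [← Rat.num_div_den a]
    field_simp
    linarith
  have hval (k : ℕ) : padicValRat p (a + k) = padicValInt p (a.num + k * a.den) := by
    have : a + k = ((a.num + k * a.den : ℤ) : ℚ) / (a.den : ℚ) := by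
      nth_rw 1 [← Rat.num_div_den a]
      field_simp
      push_cast
      ring
    rw [this, padicValRat.div (mod_cast hne k) hd, hpd, sub_zero, padicValRat.of_int]
  have hdu : (a.den : ZMod p) ≠ 0 := by
    rw [Ne, ZMod.natCast_eq_zero_iff]
    exact Nat.not_dvd_of_pos_of_lt a.den_pos hdp
  have hdvd (k : ℕ) : (p : ℤ) ∣ a.num + k * a.den ↔ (k : ZMod p) = -a.num / a.den := by
    rw [← ZMod.intCast_zmod_eq_zero_iff_dvd, eq_div_iff hdu, eq_neg_iff_add_eq_zero, add_comm]
    push_cast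
    rfl
  set k₀ := (-a.num / a.den : ZMod p).val with hk₀
  have hk₀p : k₀ < p := ZMod.val_lt _
  rw [Finset.sum_eq_single_of_mem k₀ (Finset.mem_range.2 hk₀p)]
  · rw [hval]
    have h1 : (p : ℤ) ∣ a.num + k₀ * a.den := by
      rw [hdvd, hk₀, ZMod.natCast_zmod_val]
    have h2 : ¬ (p : ℤ) ^ 2 ∣ a.num + k₀ * a.den := by
      intro h
      have h3 : p ^ 2 ∣ (a.num + k₀ * a.den).natAbs := by
        rw [← Int.natCast_dvd]; exact_mod_cast h
      have h4 := Nat.le_of_dvd (Int.natAbs_pos.2 (hne k₀)) h3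
      have h5 : (a.num + k₀ * a.den).natAbs ≤ a.num.natAbs + k₀ * a.den := by
        refine (Int.natAbs_add_le _ _).trans ?_
        rw [Int.natAbs_mul, Int.natAbs_natCast, Int.natAbs_natCast]
      nlinarith [a.den_pos]
    have h3 : 1 ≤ padicValInt p (a.num + k₀ * a.den) := by
      have := (padicValInt_dvd_iff 1 (a.num + k₀ * a.den)).1 (by simpa using h1)
      exact this.resolve_left (hne k₀)
    have h4 : ¬ 2 ≤ padicValInt p (a.num + k₀ * a.den) := fun h ↦
      h2 ((padicValInt_dvd_iff 2 _).2 (Or.inr h))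
    have : padicValInt p (a.num + k₀ * a.den) = 1 := by omega
    exact_mod_cast this
  · intro k hk hkk
    rw [hval, padicValInt.eq_zero_of_not_dvd, Nat.cast_zero]
    rw [hdvd]
    intro h
    apply hkk
    rw [hk₀, ← h, ZMod.val_natCast, Nat.mod_eq_of_lt (Finset.mem_range.1 hk)]

theorem eventually_padicValRat_sq_sub_mul_sq_eq_zero {D : ℤ} {a b : ℚ} (hb : b ≠ 0) :
    ∀ᶠ p : ℕ in atTop, p.Prime → J(D | p) = -1 → ∀ k : ℕ,
      padicValRat p ((a + k) ^ 2 - D * b ^ 2) = 0 := by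
  have hda : (a.den : ℚ) ≠ 0 := by simp
  have hdb : (b.den : ℚ) ≠ 0 := by simp
  have hd : (a.den : ℚ) * b.den ≠ 0 := mul_ne_zero hda hdb
  have hB : b.num * a.den ≠ 0 := by simpa using hb
  filter_upwards [eventually_padicValRat_eq_zero hd,
    eventually_gt_atTop (b.num * a.den).natAbs] with p hpd hpB hp hJ k
  have : Fact p.Prime := ⟨hp⟩
  have hndvd : ¬ (p : ℤ) ∣ ((a.num + k * a.den) * b.den) ^ 2 - D * (b.num * a.den) ^ 2 := by
    intro h
    have h' := (jacobiSym.prime_dvd_of_eq_neg_one hJ h).2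
    rw [Int.natCast_dvd] at h'
    exact Nat.not_dvd_of_pos_of_lt (Int.natAbs_pos.2 hB) hpB h'
  have heq : (a + k) ^ 2 - D * b ^ 2 =
      ((((a.num + k * a.den) * b.den) ^ 2 - D * (b.num * a.den) ^ 2 : ℤ) : ℚ) /
        ((a.den : ℚ) * b.den) ^ 2 := by
    nth_rw 1 [← Rat.num_div_den a, ← Rat.num_div_den b]
    field_simp
    push_cast
    ring
  rw [heq, padicValRat.div _ (pow_ne_zero 2 hd), padicValRat.pow, hpd, padicValRat.of_int,
    padicValInt.eq_zero_of_not_dvd hndvd]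
  · simp
  · intro h
    rw [Int.cast_eq_zero] at h
    exact hndvd (h ▸ dvd_zero _)

theorem ascPochhammer_eval_eq_prod_range_add {K : Type*} [CommRing K] (n : ℕ) (x : K) :
    (ascPochhammer K n).eval x = ∏ k ∈ Finset.range n, (x + k) := by
  induction n with
  | zero => simp
  | succ n ih => rw [ascPochhammer_succ_eval, Finset.prod_range_succ, ih]

theorem algebraNorm_div {F K : Type*} [Field F] [Field K] [Algebra F K] [Module.Finite F K]
    (x : K) {y : K} (hy : y ≠ 0) :
    Algebra.norm F (x / y) = Algebra.norm F x / Algebra.norm F y := by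
  rw [eq_div_iff (Algebra.norm_ne_zero_iff.2 hy), ← map_mul, div_mul_cancel₀ _ hy]

theorem ascPochhammer_eval_ne_zero {K : Type*} [Field K] {x : K}
    (hx : ∀ m : ℤ, m ≤ 0 → x ≠ (m : K)) (n : ℕ) :
    (ascPochhammer K n).eval x ≠ 0 := by
  rw [ascPochhammer_eval_eq_prod_range_add, Finset.prod_ne_zero_iff]
  intro k _ h
  refine hx (-k) (by simp) ?_
  push_cast
  exact eq_neg_of_add_eq_zero_left h

section QuadraticField

variable {K : Type*} [Field K] [CharZero K] {D : ℤ} {sqrtD : K}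

theorem exists_basis_one_sqrt (hirr : ∀ q : ℚ, (q : K) ≠ sqrtD)
    (hspan : ∀ x : K, ∃ q1 q2 : ℚ, x = (q1 : K) + (q2 : K) * sqrtD) :
    ∃ B : Module.Basis (Fin 2) ℚ K, B 0 = 1 ∧ B 1 = sqrtD := by
  have hli : LinearIndependent ℚ ![(1 : K), sqrtD] := by
    refine (LinearIndependent.pair_iff' one_ne_zero).2 fun q h ↦ hirr q ?_
    rw [← h, Rat.smul_def, mul_one]
  have hsp : ⊤ ≤ Submodule.span ℚ (Set.range ![(1 : K), sqrtD]) := by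
    rintro x -
    obtain ⟨q₁, q₂, rfl⟩ := hspan x
    rw [Matrix.range_cons, Matrix.range_cons, Matrix.range_empty, Set.union_empty,
      Set.singleton_union, Submodule.mem_span_pair]
    exact ⟨q₁, q₂, by simp [Rat.smul_def]⟩
  exact ⟨Module.Basis.mk hli hsp, by simp, by simp⟩

theorem norm_add_mul_sqrt (hsq : sqrtD ^ 2 = (D : K)) (hirr : ∀ q : ℚ, (q : K) ≠ sqrtD)
    (hspan : ∀ x : K, ∃ q1 q2 : ℚ, x = (q1 : K) + (q2 : K) * sqrtD) (a b : ℚ) :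
    Algebra.norm ℚ ((a : K) + b * sqrtD) = a ^ 2 - D * b ^ 2 := by
  obtain ⟨B, h0, h1⟩ := exists_basis_one_sqrt hirr hspan
  have e0 : ((a : K) + b * sqrtD) * B 0 = a • B 0 + b • B 1 := by
    simp [h0, h1, Rat.smul_def]
  have e1 : ((a : K) + b * sqrtD) * B 1 = (D * b : ℚ) • B 0 + a • B 1 := by
    simp only [h0, h1, Rat.smul_def]
    push_cast
    linear_combination (b : K) * hsq
  rw [Algebra.norm_eq_matrix_det B, Matrix.det_fin_two]
  simp only [Algebra.leftMulMatrix_eq_repr_mul, e0, e1]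
  simp
  ring

theorem eventually_padicValRat_norm_ascPochhammer (hsq : sqrtD ^ 2 = (D : K))
    (hirr : ∀ q : ℚ, (q : K) ≠ sqrtD)
    (hspan : ∀ x : K, ∃ q1 q2 : ℚ, x = (q1 : K) + (q2 : K) * sqrtD)
    {x : K} (hx : ∀ m : ℤ, m ≤ 0 → x ≠ (m : K)) [Decidable (∃ q : ℚ, x = (q : K))] :
    ∀ᶠ p : ℕ in atTop, p.Prime → J(D | p) = -1 →
      padicValRat p (Algebra.norm ℚ ((ascPochhammer K p).eval x)) =
        if ∃ q : ℚ, x = (q : K) then 2 else 0 := by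
  obtain ⟨a, b, rfl⟩ := hspan x
  have hnorm (k : ℕ) : Algebra.norm ℚ ((a : K) + b * sqrtD + k) = (a + k) ^ 2 - D * b ^ 2 := by
    rw [← norm_add_mul_sqrt hsq hirr hspan]
    push_cast
    ring_nf
  have hmod : Module.Finite ℚ K :=
    let ⟨B, _⟩ := exists_basis_one_sqrt hirr hspan
    .of_basis B
  have hne (k : ℕ) : (a + k : ℚ) ^ 2 - D * b ^ 2 ≠ 0 := by
    rw [← hnorm, Algebra.norm_ne_zero_iff]
    intro h
    refine hx (-k) (by simp) ?_
    push_cast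
    exact eq_neg_of_add_eq_zero_left h
  have hval (p : ℕ) (hp : p.Prime) :
      padicValRat p (Algebra.norm ℚ ((ascPochhammer K p).eval ((a : K) + b * sqrtD))) =
        ∑ k ∈ Finset.range p, padicValRat p ((a + k) ^ 2 - D * b ^ 2) := by
    have : Fact p.Prime := ⟨hp⟩
    rw [ascPochhammer_eval_eq_prod_range_add, map_prod, ← padicValRat_prod p _ _ fun k _ ↦ hne k]
    simp only [hnorm]
  by_cases hb : b = 0
  · subst hb
    rw [if_pos ⟨a, by simp⟩]
    simp only [ne_eq, OfNat.ofNat_ne_zero, not_false_eq_true, zero_pow, mul_zero,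
      sub_zero] at hne hval
    filter_upwards [eventually_sum_padicValRat_add_eq_one fun k ↦
      (pow_ne_zero_iff two_ne_zero).1 (hne k)] with p hp hpp _
    have : Fact p.Prime := ⟨hpp⟩
    simp only [hval p hpp, padicValRat.pow, ← Finset.mul_sum, hp hpp]
    norm_num
  · rw [if_neg]
    · filter_upwards [eventually_padicValRat_sq_sub_mul_sq_eq_zero (D := D) (a := a) hb]
        with p hp hpp hJ
      rw [hval p hpp]
      exact Finset.sum_eq_zero fun k _ ↦ hp hpp hJ k
    · rintro ⟨q, hq⟩
      apply hirr ((q - a) / b)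
      have hb' : (b : K) ≠ 0 := mod_cast hb
      push_cast
      rw [← hq]
      field_simp
      ring

end QuadraticField

theorem padicValRat_nonneg_of_isIntegral (p : ℕ) {x : ℚ} (hx : IsIntegral ℤ x) :
    0 ≤ padicValRat p x := by
  obtain ⟨z, rfl⟩ := IsIntegrallyClosed.isIntegral_iff.1 hx
  rw [eq_intCast, padicValRat.of_int]
  positivity

/-- Theorem 1.4(i): let `D` be a square-free integer other than 1 and `K = ℚ(√D)`.
If the number `u` of rational components of `α` is smaller than the number `v` of
rational components of `β`, then `F_{α,β}(z)` is not N-integral in `K`. -/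
theorem stmt4 (D : ℤ) (hD : Squarefree D) (hD1 : D ≠ 1)
    (K : Type*) [Field K] [CharZero K] (sqrtD : K)
    (hsq : sqrtD ^ 2 = (D : K))
    (hirr : ∀ q : ℚ, (q : K) ≠ sqrtD)
    (hspan : ∀ x : K, ∃ q1 q2 : ℚ, x = (q1 : K) + (q2 : K) * sqrtD)
    {r s : ℕ} (hr : 0 < r) (hs : 0 < s)
    (α : Fin r → K) (β : Fin s → K)
    (hα : ∀ i, ∀ m : ℤ, m ≤ 0 → α i ≠ (m : K))
    (hβ : ∀ j, ∀ m : ℤ, m ≤ 0 → β j ≠ (m : K))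
    (u v : ℕ)
    (hu : u = Nat.card {i : Fin r // ∃ q : ℚ, α i = (q : K)})
    (hv : v = Nat.card {j : Fin s // ∃ q : ℚ, β j = (q : K)})
    (huv : u < v) :
    ¬ ∃ c : K, c ≠ 0 ∧ ∀ n : ℕ, IsIntegral ℤ (c ^ n * hgCoeffK α β n) := by
  classical
  rintro ⟨c, hc, hint⟩
  have hmod : Module.Finite ℚ K :=
    let ⟨B, _⟩ := exists_basis_one_sqrt hirr hspan
    .of_basis B
  have hcN : Algebra.norm ℚ c ≠ 0 := Algebra.norm_ne_zero_iff.2 hc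
  obtain ⟨p, ⟨hp, hJ⟩, hpc, hpα, hpβ⟩ :=
    ((frequently_prime_and_jacobiSym_eq_neg_one hD hD1).and_eventually
      ((eventually_padicValRat_eq_zero hcN).and
        ((eventually_all.2 fun i ↦
            eventually_padicValRat_norm_ascPochhammer hsq hirr hspan (hα i)).and
          (eventually_all.2 fun j ↦
            eventually_padicValRat_norm_ascPochhammer hsq hirr hspan (hβ j))))).exists
  have : Fact p.Prime := ⟨hp⟩
  have hα0 (i : Fin r) : Algebra.norm ℚ ((ascPochhammer K p).eval (α i)) ≠ 0 :=
    Algebra.norm_ne_zero_iff.2 (ascPochhammer_eval_ne_zero (hα i) p)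
  have hβ0 (j : Fin s) : Algebra.norm ℚ ((ascPochhammer K p).eval (β j)) ≠ 0 :=
    Algebra.norm_ne_zero_iff.2 (ascPochhammer_eval_ne_zero (hβ j) p)
  have hval := padicValRat_nonneg_of_isIntegral p (Algebra.isIntegral_norm ℚ (hint p))
  rw [hgCoeffK, map_mul, map_pow,
    algebraNorm_div _ (Finset.prod_ne_zero_iff.2 fun j _ ↦ ascPochhammer_eval_ne_zero (hβ j) p),
    map_prod, map_prod,
    padicValRat.mul (pow_ne_zero _ hcN) (div_ne_zero (Finset.prod_ne_zero_iff.2 fun i _ ↦ hα0 i)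
      (Finset.prod_ne_zero_iff.2 fun j _ ↦ hβ0 j)),
    padicValRat.div (Finset.prod_ne_zero_iff.2 fun i _ ↦ hα0 i)
      (Finset.prod_ne_zero_iff.2 fun j _ ↦ hβ0 j), padicValRat.pow, hpc,
    padicValRat_prod p _ _ fun i _ ↦ hα0 i, padicValRat_prod p _ _ fun j _ ↦ hβ0 j,
    Finset.sum_congr rfl fun i _ ↦ hpα i hp hJ, Finset.sum_congr rfl fun j _ ↦ hpβ j hp hJ] at hval
  rw [Nat.card_eq_fintype_card, Fintype.card_subtype] at hu hv
  simp only [Finset.sum_ite, Finset.sum_const, ← hu, ← hv] at hval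
  simp at hval
  omega
end
end

section
/- Let α = (α_1,…,α_r) and β = (β_1,…,β_s) with all α_i, β_j ∈ ℚ∖ℤ_{≤0}, let l ≥ 2 be an integer, and let p be a prime with p > M_{α,β}. Let n and e be integers with 1 ≤ n ≤ p and 0 ≤ e ≤ d_{α,β} such that either (n = p and e = d_{α,β}) or e/d_{α,β} < n/p < (e+1)/d_{α,β}. Then Σ_{i=1}^{r} ⌈n/p + α_i/p^l − 𝔇_p^l(α_i)⌉ − Σ_{j=1}^{s} ⌈n/p + β_j/p^l − 𝔇_p^l(β_j)⌉ = #{1≤i≤r : 𝔇_p^l(α_i) ≤ e/d_{α,β}} − #{1≤j≤s : 𝔇_p^l(β_j) ≤ e/d_{α,β}}. -/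
open scoped BigOperators

noncomputable section

/-- `d_{α,β}`: the lcm of the exact denominators of the components of `α` and `β`. -/
def dab {r s : ℕ} (α : Fin r → ℚ) (β : Fin s → ℚ) : ℕ :=
  Nat.lcm (Finset.univ.lcm fun i => (α i).den) (Finset.univ.lcm fun j => (β j).den)

/-- `T_{p,l}(γ)` for a rational `γ` with `p ∤ den(γ)`: the unique element of
`{0,…,p^l−1}` congruent to `−γ` modulo `p^l` (computed via `ZMod (p^l)`). -/
def Tnum (p l : ℕ) (γ : ℚ) : ℕ :=
  ((((-γ.num : ℤ) : ZMod (p ^ l)) * ((γ.den : ZMod (p ^ l)))⁻¹)).val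

/-- The `l`-th iterate `𝔇_p^l(γ)` of the Dwork map of a rational `γ ∈ ℤ_p`:
the unique `δ` with `p^l·δ − γ ∈ {0,…,p^l−1}`, i.e. `δ = (γ + T_{p,l}(γ))/p^l`. -/
def dworkIter (p l : ℕ) (γ : ℚ) : ℚ := (γ + (Tnum p l γ : ℚ)) / (p : ℚ) ^ l

/-- The defining congruence of `Tnum`: `p ^ l` divides `num γ + den γ * T`. -/
lemma pow_dvd_num_add_den_mul_Tnum {p l : ℕ} (hp : 0 < p) {γ : ℚ} (h : Nat.Coprime γ.den p) :
    (p : ℤ) ^ l ∣ γ.num + γ.den * (Tnum p l γ : ℤ) := by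
  have : NeZero (p ^ l) := ⟨(pow_pos hp l).ne'⟩
  have h0 : ((γ.num + γ.den * (Tnum p l γ : ℤ) : ℤ) : ZMod (p ^ l)) = 0 := by
    unfold Tnum
    push_cast
    rw [ZMod.natCast_zmod_val]
    linear_combination
      (-(γ.num : ZMod (p ^ l))) * ZMod.coe_mul_inv_eq_one γ.den (h.pow_right l)
  exact_mod_cast (ZMod.intCast_zmod_eq_zero_iff_dvd _ _).1 h0

lemma Tnum_lt {p l : ℕ} (hp : 0 < p) (γ : ℚ) : Tnum p l γ < p ^ l :=
  have : NeZero (p ^ l) := ⟨(pow_pos hp l).ne'⟩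
  ZMod.val_lt _

/-- For `p` large, `𝔇_p^l(γ) = k / d` with `1 ≤ k ≤ d` whenever `d` is a multiple of the
denominator of `γ`; moreover `k = d` forces `γ > 0`. Here `a = d * γ`. -/
lemma exists_dworkIter_eq_div {p l d : ℕ} (hp : p.Prime) (hl : 1 ≤ l) {γ : ℚ}
    (hγ : ∀ m : ℤ, m ≤ 0 → γ ≠ m) (hd : 0 < d) (hden : γ.den ∣ d)
    (hM : (d : ℚ) * (2 + 2 * |γ|) < p) :
    ∃ k a : ℤ, dworkIter p l γ = k / d ∧ γ = a / d ∧ |a| < p ∧ 1 ≤ k ∧ k ≤ d ∧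
      (k = d → 0 < a) := by
  have hdQ : (0 : ℚ) < d := by exact_mod_cast hd
  have hpQ : (0 : ℚ) < p := by exact_mod_cast hp.pos
  obtain ⟨c, hc⟩ := hden
  have hdp : d < p := by
    have : (d : ℚ) < p := by nlinarith [mul_nonneg hdQ.le (abs_nonneg γ)]
    exact_mod_cast this
  have hcop : Nat.Coprime γ.den p := by
    refine Nat.Coprime.symm ((hp.coprime_iff_not_dvd).2 fun hdvd => ?_)
    exact absurd (Nat.le_of_dvd hd (hdvd.trans ⟨c, hc⟩)) (by omega)
  obtain ⟨m, hm⟩ := pow_dvd_num_add_den_mul_Tnum (l := l) hp.pos hcop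
  have hT : (Tnum p l γ : ℤ) + 1 ≤ (p : ℤ) ^ l := by exact_mod_cast Tnum_lt hp.pos γ
  have hγa : γ = ((γ.num * c : ℤ) : ℚ) / d := by
    rw [eq_div_iff hdQ.ne', hc]
    push_cast
    linear_combination (c : ℚ) * Rat.mul_den_eq_num γ
  have hkey : (γ.num * c : ℤ) + d * (Tnum p l γ : ℤ) = (p : ℤ) ^ l * (m * c) := by
    rw [hc]
    push_cast
    linear_combination (c : ℤ) * hm
  generalize γ.num * (c : ℤ) = a at hγa hkey
  generalize m * (c : ℤ) = k at hkey
  have hkeyQ : (a : ℚ) + d * (Tnum p l γ : ℚ) = (p : ℚ) ^ l * k := by exact_mod_cast hkey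
  have ha : |a| < p := by
    have h1 : (|a| : ℚ) = d * |γ| := by
      rw [hγa, abs_div, abs_of_pos hdQ]
      field_simp
    have : ((|a| : ℤ) : ℚ) < p := by
      push_cast
      rw [h1]
      nlinarith [mul_nonneg hdQ.le (abs_nonneg γ)]
    exact_mod_cast this
  have hpl : (p : ℤ) ≤ (p : ℤ) ^ l := by exact_mod_cast Nat.le_self_pow (by omega) p
  have hdZ : (0 : ℤ) < d := by exact_mod_cast hd
  have hT0 : (0 : ℤ) ≤ Tnum p l γ := Int.natCast_nonneg _
  obtain ⟨ha1, ha2⟩ := abs_lt.1 ha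
  have hP : (0 : ℤ) < (p : ℤ) ^ l := by exact_mod_cast pow_pos hp.pos l
  have hk0 : 0 ≤ k := by
    by_contra! h
    nlinarith [mul_nonneg hdZ.le hT0]
  refine ⟨k, a, ?_, hγa, ha, ?_, ?_, ?_⟩
  · unfold dworkIter
    rw [div_eq_div_iff (pow_pos hpQ l).ne' hdQ.ne']
    have : γ * d = a := by rw [hγa]; field_simp
    linear_combination this + hkeyQ
  · rcases hk0.lt_or_eq with h | h
    · exact h
    · refine absurd ?_ (hγ (-(Tnum p l γ : ℤ)) (by omega))
      rw [← h] at hkeyQ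
      refine hγa.trans ((div_eq_iff hdQ.ne').2 ?_)
      push_cast at hkeyQ ⊢
      linear_combination hkeyQ
  · by_contra! h
    nlinarith
  · rintro rfl
    nlinarith

/-- Each ceiling is the indicator of `𝔇_p^l(γ) ≤ e / d`. -/
lemma ceil_sub_dworkIter_eq_ite {p l d : ℕ} (hp : p.Prime) (hl : 2 ≤ l) {γ : ℚ}
    (hγ : ∀ m : ℤ, m ≤ 0 → γ ≠ m) (hd : 0 < d) (hden : γ.den ∣ d)
    (hM : (d : ℚ) * (2 + 2 * |γ|) < p) {n e : ℕ} (hn1 : 1 ≤ n) (hnp : n ≤ p)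
    (hcase : (n = p ∧ e = d) ∨
      ((e : ℚ) / d < (n : ℚ) / p ∧ (n : ℚ) / p < ((e : ℚ) + 1) / d)) :
    ⌈(n : ℚ) / p + γ / (p : ℚ) ^ l - dworkIter p l γ⌉ =
      if dworkIter p l γ ≤ (e : ℚ) / d then 1 else 0 := by
  have hdQ : (0 : ℚ) < d := by exact_mod_cast hd
  have hpQ : (0 : ℚ) < p := by exact_mod_cast hp.pos
  obtain ⟨k, a, hk, hγa, ha, hk1, hkd, hkpos⟩ :=
    exists_dworkIter_eq_div hp (by omega : 1 ≤ l) hγ hd hden hM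
  obtain ⟨t, rfl⟩ : ∃ t, l = t + 1 := ⟨l - 1, by omega⟩
  obtain ⟨q, hq⟩ : ∃ q : ℤ, q = (p : ℤ) ^ t := ⟨_, rfl⟩
  have hpq : (p : ℤ) ≤ q := by
    rw [hq]
    exact_mod_cast Nat.le_self_pow (by omega) p
  have hqQ : (p : ℚ) ^ t = q := by rw [hq]; push_cast; rfl
  have hpZ : (0 : ℤ) < p := by exact_mod_cast hp.pos
  have hdZ : (0 : ℤ) < d := by exact_mod_cast hd
  have hn1Z : (1 : ℤ) ≤ n := by exact_mod_cast hn1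
  have hnpZ : (n : ℤ) ≤ p := by exact_mod_cast hnp
  have hq0 : 0 < q := by omega
  have hq0Q : (0 : ℚ) < q := by exact_mod_cast hq0
  have hx : (n : ℚ) / p + γ / (p : ℚ) ^ (t + 1) - dworkIter p (t + 1) γ =
      ((n * d * q + a - k * p * q : ℤ) : ℚ) / ((d * p * q : ℤ) : ℚ) := by
    rw [hk, hγa, pow_succ, hqQ]
    push_cast
    field_simp
  have hD : (0 : ℚ) < ((d * p * q : ℤ) : ℚ) := by push_cast; positivity
  have hcase' : ((n : ℤ) = p ∧ (e : ℤ) = d) ∨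
      ((e : ℤ) * p + 1 ≤ n * d ∧ (n : ℤ) * d + 1 ≤ (e + 1) * p) := by
    refine hcase.imp (fun h => ⟨by rw [h.1], by rw [h.2]⟩) fun h => ?_
    rw [div_lt_div_iff₀ hdQ hpQ, div_lt_div_iff₀ hpQ hdQ] at h
    exact ⟨by exact_mod_cast h.1, by exact_mod_cast h.2⟩
  obtain ⟨ha1, ha2⟩ := abs_lt.1 ha
  have hcmp : dworkIter p (t + 1) γ ≤ (e : ℚ) / d ↔ k ≤ e := by
    rw [hk, div_le_div_iff_of_pos_right hdQ]
    exact_mod_cast Iff.rfl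
  rw [hx]
  simp only [hcmp]
  split_ifs with hke
  · have hupper : (n * d * q + a - k * p * q : ℤ) ≤ d * p * q := by
      have h1 : (n : ℤ) * d * q ≤ p * d * q := by gcongr
      have h2 : 1 * (p : ℤ) * q ≤ k * p * q := by gcongr
      nlinarith
    have hlower : (0 : ℤ) < n * d * q + a - k * p * q := by
      rcases hcase' with ⟨h1, h2⟩ | ⟨h1, h2⟩
      · rw [h1]
        rcases hkd.lt_or_eq with h | h
        · have h3 : (k + 1) * p * q ≤ d * p * q := by gcongr; exact h
          nlinarith
        · have := hkpos h
          rw [h]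
          linarith
      · have h3 : k * (p : ℤ) + 1 ≤ n * d := by nlinarith
        have h4 : (k * (p : ℤ) + 1) * q ≤ n * d * q := by gcongr
        linarith
    rw [Int.ceil_eq_iff, lt_div_iff₀ hD, div_le_iff₀ hD]
    constructor
    · have : (0 : ℚ) < _ := Int.cast_pos.2 hlower
      simpa using this
    · have := (Int.cast_le (R := ℚ)).2 hupper
      simpa using this
  · push Not at hke
    have hupper : (n * d * q + a - k * p * q : ℤ) ≤ 0 := by
      rcases hcase' with ⟨h1, h2⟩ | ⟨h1, h2⟩
      · omega
      · have h3 : (n : ℤ) * d + 1 ≤ k * p := by nlinarith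
        have h4 : ((n : ℤ) * d + 1) * q ≤ k * p * q := by gcongr
        linarith
    have hlower : -(d * p * q : ℤ) < n * d * q + a - k * p * q := by
      have h1 : k * (p : ℤ) * q ≤ d * p * q := by gcongr
      have h2 : 1 * 1 * q ≤ (n : ℤ) * d * q := by gcongr; exact hdZ
      linarith
    rw [Int.ceil_eq_iff, lt_div_iff₀ hD, div_le_iff₀ hD]
    constructor
    · have := (Int.cast_lt (R := ℚ)).2 hlower
      simpa using this
    · have := (Int.cast_le (R := ℚ)).2 hupper
      simpa using this

lemma sum_ite_eq_natCard {ι : Type*} [Fintype ι] (P : ι → Prop) [DecidablePred P] :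
    ∑ i, (if P i then (1 : ℤ) else 0) = (Nat.card {i // P i} : ℤ) := by
  rw [Finset.sum_boole, Nat.card_eq_fintype_card, Fintype.card_subtype]

/-- Lemma 2.10: let `l ≥ 2` and `p > M_{α,β}` be prime. For integers `n, e` with
`1 ≤ n ≤ p`, `0 ≤ e ≤ d_{α,β}` such that either `n = p` and `e = d_{α,β}`, or
`e/d_{α,β} < n/p < (e+1)/d_{α,β}`, one has
`Σ_i ⌈n/p + α_i/p^l − 𝔇_p^l(α_i)⌉ − Σ_j ⌈n/p + β_j/p^l − 𝔇_p^l(β_j)⌉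
  = #{i : 𝔇_p^l(α_i) ≤ e/d_{α,β}} − #{j : 𝔇_p^l(β_j) ≤ e/d_{α,β}}`. -/
theorem stmt14 {r s : ℕ} (hr : 0 < r) (hs : 0 < s)
    (α : Fin r → ℚ) (β : Fin s → ℚ)
    (hα : ∀ i, ∀ m : ℤ, m ≤ 0 → α i ≠ (m : ℚ))
    (hβ : ∀ j, ∀ m : ℤ, m ≤ 0 → β j ≠ (m : ℚ))
    (p : ℕ) (hp : p.Prime)
    (hpM : ∀ i, (p : ℚ) > (dab α β : ℚ) * (2 + 2 * |α i|))
    (hpM' : ∀ j, (p : ℚ) > (dab α β : ℚ) * (2 + 2 * |β j|))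
    (l : ℕ) (hl : 2 ≤ l)
    (n e : ℕ) (hn1 : 1 ≤ n) (hnp : n ≤ p) (he : e ≤ dab α β)
    (hcase : (n = p ∧ e = dab α β) ∨
      ((e : ℚ) / (dab α β : ℚ) < (n : ℚ) / (p : ℚ) ∧
        (n : ℚ) / (p : ℚ) < ((e : ℚ) + 1) / (dab α β : ℚ))) :
    ∑ i, ⌈(n : ℚ) / (p : ℚ) + α i / (p : ℚ) ^ l - dworkIter p l (α i)⌉
        - ∑ j, ⌈(n : ℚ) / (p : ℚ) + β j / (p : ℚ) ^ l - dworkIter p l (β j)⌉ =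
      (Nat.card {i : Fin r // dworkIter p l (α i) ≤ (e : ℚ) / (dab α β : ℚ)} : ℤ)
        - (Nat.card {j : Fin s // dworkIter p l (β j) ≤ (e : ℚ) / (dab α β : ℚ)} : ℤ) := by
  have hdpos : 0 < dab α β := by
    refine Nat.pos_of_ne_zero fun h => ?_
    simp [dab, Nat.lcm_eq_zero_iff, Finset.lcm_eq_zero_iff] at h
  have hdα : ∀ i, (α i).den ∣ dab α β := fun i =>
    (Finset.dvd_lcm (f := fun i => (α i).den) (Finset.mem_univ i)).trans (Nat.dvd_lcm_left _ _)
  have hdβ : ∀ j, (β j).den ∣ dab α β := fun j =>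
    (Finset.dvd_lcm (f := fun j => (β j).den) (Finset.mem_univ j)).trans (Nat.dvd_lcm_right _ _)
  rw [Finset.sum_congr rfl fun i _ => ceil_sub_dworkIter_eq_ite hp hl (hα i) hdpos (hdα i)
      (hpM i) hn1 hnp hcase,
    Finset.sum_congr rfl fun j _ => ceil_sub_dworkIter_eq_ite hp hl (hβ j) hdpos (hdβ j)
      (hpM' j) hn1 hnp hcase,
    sum_ite_eq_natCard, sum_ite_eq_natCard]
end
end
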